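/- arXiv:1011.1941 — 9 statements merged into one kernel-verified Lean document; each statement's English description precedes it below -/
import Mathlib

section
/- Let O be a nonempty type and ρ : O → ℝ^K a payoff function whose range is bounded. Suppose C : ℝ^K → ℝ is convex and differentiable everywhere, and satisfies the no-arbitrage condition: for all q, r ∈ ℝ^K there exists o ∈ O such that C(q + r) − C(q) ≥ ⟨r, ρ(o)⟩. Then for every q ∈ ℝ^K, the gradient ∇C(q) lies in the closure of the convex hull of the set ρ(O) = {ρ(o) : o ∈ O}. -/
open RealInnerProductSpace

/-- **No arbitrage keeps prices in the convex hull of payoffs.**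
If `C` is convex, differentiable, and satisfies the no-arbitrage condition with
respect to a bounded payoff function `ρ`, then every gradient of `C` lies in the
closure of the convex hull of the set of payoff vectors. -/
theorem no_arbitrage_gradient_in_hull
    {K : ℕ} {O : Type*} [Nonempty O]
    (ρ : O → EuclideanSpace ℝ (Fin K))
    (hbdd : Bornology.IsBounded (Set.range ρ))
    (C : EuclideanSpace ℝ (Fin K) → ℝ)
    (hconv : ConvexOn ℝ Set.univ C)
    (hdiff : Differentiable ℝ C)
    (hnoarb : ∀ q r : EuclideanSpace ℝ (Fin K),
      ∃ o : O, C (q + r) - C q ≥ ⟪r, ρ o⟫) :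
    ∀ q : EuclideanSpace ℝ (Fin K),
      gradient C q ∈ closure (convexHull ℝ (Set.range ρ)) := by
  intro q
  by_contra hq
  obtain ⟨f, u, hfu, hb⟩ := geometric_hahn_banach_point_closed
    (convex_convexHull ℝ (Set.range ρ)).closure isClosed_closure hq
  set v := (InnerProductSpace.toDual ℝ (EuclideanSpace ℝ (Fin K))).symm f with hv
  have hf : ∀ x, f x = ⟪v, x⟫ := fun x => by
    rw [hv, InnerProductSpace.toDual_symm_apply]
  have hline : HasDerivAt (fun t : ℝ => q + t • v) v 0 := by
    simpa using ((hasDerivAt_id (0 : ℝ)).smul_const v).const_add q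
  have hC : HasFDerivAt C (fderiv ℝ C q) (q + (0 : ℝ) • v) := by
    simpa using (hdiff q).hasFDerivAt
  have hg : HasDerivAt (fun t : ℝ => C (q + t • v)) (fderiv ℝ C q v) 0 :=
    hC.comp_hasDerivAt (0 : ℝ) hline
  have hval : fderiv ℝ C q v = f (gradient C q) := by
    rw [hf, real_inner_comm, gradient, InnerProductSpace.toDual_symm_apply]
  have ht := (hasDerivAt_iff_tendsto_slope.1 hg).mono_left
    (nhdsWithin_mono (0 : ℝ) (fun x (hx : x ∈ Set.Ioi (0 : ℝ)) => ne_of_gt hx))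
  have hle : u ≤ fderiv ℝ C q v := by
    refine ge_of_tendsto ht ?_
    filter_upwards [self_mem_nhdsWithin] with t htpos
    have htpos : 0 < t := htpos
    obtain ⟨o, ho⟩ := hnoarb q (t • v)
    have h1 := hb (ρ o) (subset_closure (subset_convexHull ℝ _ ⟨o, rfl⟩))
    rw [hf] at h1
    rw [real_inner_smul_left] at ho
    rw [slope_def_field, le_div_iff₀ (by simpa using htpos)]
    simp only [zero_smul, add_zero, sub_zero]
    nlinarith
  linarith
end

section
/- Let O be a nonempty type and ρ : O → ℝ^K a payoff function, and suppose Π := convexHull(ρ(O)) is compact. Let R : ℝ^K → ℝ be continuous, and define the cost function C(q) = sup_{x ∈ Π} (⟨x, q⟩ − R(x)). Fix q ∈ ℝ^K and o ∈ O, and suppose x_q ∈ Π attains the supremum defining C(q) and that R is differentiable at x_q. Then the market maker's monetary loss satisfies ⟨ρ(o), q⟩ − C(q) + C(0) ≤ R(ρ(o)) − min_{x ∈ Π} R(x) − D_R(ρ(o), x_q), where D_R(a, b) := R(a) − R(b) − ⟨∇R(b), a − b⟩ is the Bregman divergence of R. -/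
open RealInnerProductSpace

/-- **Bound on the market maker's monetary loss (Theorem 3).**
With feasible price region `Pi = convexHull (ρ(O))` compact, conjugate `R`
continuous, cost function `C q = sup_{x ∈ Pi} (⟪x, q⟫ − R x)`, final quantity
vector `q` with the supremum attained at price vector `x_q` where `R` is
differentiable, the loss `⟪ρ(o), q⟫ − C q + C 0` of the market maker on outcome
`o` is at most `R(ρ(o)) − min_{x ∈ Pi} R(x) − D_R(ρ(o), x_q)`. -/
theorem market_maker_loss_bound
    {K : ℕ} {O : Type*} [Nonempty O]
    (ρ : O → EuclideanSpace ℝ (Fin K))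
    (hcompact : IsCompact (convexHull ℝ (Set.range ρ)))
    (R : EuclideanSpace ℝ (Fin K) → ℝ) (hRcont : Continuous R)
    (C : EuclideanSpace ℝ (Fin K) → ℝ)
    (hC : ∀ q : EuclideanSpace ℝ (Fin K),
      C q = sSup ((fun x => ⟪x, q⟫ - R x) '' convexHull ℝ (Set.range ρ)))
    (q : EuclideanSpace ℝ (Fin K)) (o : O)
    (xq : EuclideanSpace ℝ (Fin K))
    (hxq : xq ∈ convexHull ℝ (Set.range ρ))
    (hattain : C q = ⟪xq, q⟫ - R xq)
    (hdiff : DifferentiableAt ℝ R xq) :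
    ⟪ρ o, q⟫ - C q + C 0 ≤
      R (ρ o) - sInf (R '' convexHull ℝ (Set.range ρ))
        - (R (ρ o) - R xq - ⟪gradient R xq, ρ o - xq⟫) := by
  have hmemo : ρ o ∈ convexHull ℝ (Set.range ρ) :=
    subset_convexHull ℝ _ (Set.mem_range_self o)
  have hC0 : C 0 ≤ - sInf (R '' convexHull ℝ (Set.range ρ)) := by
    rw [hC 0]
    apply csSup_le (Set.Nonempty.image _ ⟨_, hmemo⟩)
    rintro _ ⟨x, hx, rfl⟩
    have h := csInf_le (hcompact.image hRcont).bddBelow (Set.mem_image_of_mem R hx)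
    simp only [inner_zero_right]
    linarith
  have hmax : ∀ x ∈ convexHull ℝ (Set.range ρ), ⟪x, q⟫ - R x ≤ ⟪xq, q⟫ - R xq := by
    intro x hx
    rw [← hattain, hC q]
    have hcont : Continuous (fun x : EuclideanSpace ℝ (Fin K) => ⟪x, q⟫ - R x) := by
      fun_prop
    exact le_csSup (hcompact.image hcont).bddAbove ⟨x, hx, rfl⟩
  have hmin : IsLocalMinOn (fun x => R x - ⟪q, x⟫) (convexHull ℝ (Set.range ρ)) xq := by
    apply IsMinOn.localize
    intro x hx
    have h := hmax x hx
    simp only [Set.mem_setOf_eq]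
    rw [real_inner_comm x q, real_inner_comm xq q]
    linarith
  have hder : HasFDerivAt (fun x => R x - ⟪q, x⟫) (fderiv ℝ R xq - innerSL ℝ q) xq :=
    hdiff.hasFDerivAt.sub (innerSL ℝ q).hasFDerivAt
  have hpos := hmin.hasFDerivWithinAt_nonneg hder.hasFDerivWithinAt
    (sub_mem_posTangentConeAt_of_segment_subset
      ((convex_convexHull ℝ (Set.range ρ)).segment_subset hxq hmemo))
  have hgrad : ⟪gradient R xq, ρ o - xq⟫ = fderiv ℝ R xq (ρ o - xq) := by
    simp [gradient]
  have hq : ⟪q, ρ o - xq⟫ = ⟪ρ o, q⟫ - ⟪xq, q⟫ := by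
    rw [inner_sub_right, real_inner_comm (ρ o) q, real_inner_comm xq q]
  rw [ContinuousLinearMap.sub_apply, innerSL_apply_apply, hq, ← hgrad] at hpos
  linarith
end

section
/- Let O be a nonempty type and ρ : O → ℝ^K a payoff function, and suppose Π := convexHull(ρ(O)) is compact. Let R : ℝ^K → ℝ be convex and continuous, and define the cost function C(q) = sup_{x ∈ Π} (⟨x, q⟩ − R(x)). Fix q ∈ ℝ^K and o ∈ O, and suppose some x_q ∈ Π attains the supremum defining C(q) and that R is differentiable at x_q. Then ⟨ρ(o), q⟩ − C(q) + C(0) ≤ sup_{x ∈ ρ(O)} R(x) − min_{x ∈ Π} R(x). -/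
open RealInnerProductSpace

/-- **Worst-case market maker loss bound (Theorem 3, second part).**
With feasible price region `Pi = convexHull (ρ(O))` compact, convex continuous
conjugate `R`, and cost function `C q = sup_{x ∈ Pi} (⟪x, q⟫ − R x)` whose
supremum at `q` is attained at a differentiability point of `R`, the market
maker's loss is at most `sup_{x ∈ ρ(O)} R(x) − min_{x ∈ Pi} R(x)`. -/
theorem market_maker_worst_case_loss_bound
    {K : ℕ} {O : Type*} [Nonempty O]
    (ρ : O → EuclideanSpace ℝ (Fin K))
    (hcompact : IsCompact (convexHull ℝ (Set.range ρ)))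
    (R : EuclideanSpace ℝ (Fin K) → ℝ)
    (hRconv : ConvexOn ℝ Set.univ R) (hRcont : Continuous R)
    (C : EuclideanSpace ℝ (Fin K) → ℝ)
    (hC : ∀ q : EuclideanSpace ℝ (Fin K),
      C q = sSup ((fun x => ⟪x, q⟫ - R x) '' convexHull ℝ (Set.range ρ)))
    (q : EuclideanSpace ℝ (Fin K)) (o : O)
    (xq : EuclideanSpace ℝ (Fin K))
    (hxq : xq ∈ convexHull ℝ (Set.range ρ))
    (hattain : C q = ⟪xq, q⟫ - R xq)
    (hdiff : DifferentiableAt ℝ R xq) :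
    ⟪ρ o, q⟫ - C q + C 0 ≤
      sSup (R '' Set.range ρ) - sInf (R '' convexHull ℝ (Set.range ρ)) := by
  have hsub : Set.range ρ ⊆ convexHull ℝ (Set.range ρ) := subset_convexHull ℝ _
  have ho : ρ o ∈ convexHull ℝ (Set.range ρ) := hsub ⟨o, rfl⟩
  -- the cost at `q` dominates the value at the price vector `ρ o`
  have h1 : ⟪ρ o, q⟫ - R (ρ o) ≤ C q := by
    rw [hC q]
    have hcont : Continuous (fun x : EuclideanSpace ℝ (Fin K) => ⟪x, q⟫ - R x) := by
      fun_prop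
    exact le_csSup (hcompact.image hcont).bddAbove ⟨ρ o, ho, rfl⟩
  -- `C 0` is at most minus the minimum of `R`
  have h2 : C 0 ≤ - sInf (R '' convexHull ℝ (Set.range ρ)) := by
    rw [hC 0]
    refine csSup_le ⟨_, ρ o, ho, rfl⟩ ?_
    rintro _ ⟨x, hx, rfl⟩
    have h := csInf_le (hcompact.image hRcont).bddBelow (Set.mem_image_of_mem R hx)
    simp only [inner_zero_right]
    linarith
  have h3 : R (ρ o) ≤ sSup (R '' Set.range ρ) :=
    le_csSup ((hcompact.image hRcont).bddAbove.mono (Set.image_mono hsub))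
      ⟨ρ o, ⟨o, rfl⟩, rfl⟩
  linarith
end

section
/- Let β > 0 and let C : ℝ^K → ℝ be twice continuously differentiable with ⟨∇²C(q) u, u⟩ ≤ ‖u‖²/β for all q, u ∈ ℝ^K. Then for all q, r ∈ ℝ^K, the bid-ask spread of the bundle r satisfies (C(q + r) − C(q)) − (C(q) − C(q − r)) ≤ 2‖r‖²/β. -/
open RealInnerProductSpace

/-- **Bid-ask spread bound from market depth (Theorem 4, first part).**
If `C` is twice continuously differentiable with all Hessian eigenvalues at most
`1/β`, then the bid-ask spread of any bundle `r` at any quantity vector `q` is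
at most `2‖r‖²/β`. -/
theorem bid_ask_spread_bound_of_market_depth
    {K : ℕ} (β : ℝ) (hβ : 0 < β)
    (C : EuclideanSpace ℝ (Fin K) → ℝ)
    (hC : ContDiff ℝ 2 C)
    (hhess : ∀ q u : EuclideanSpace ℝ (Fin K),
      ⟪fderiv ℝ (fun p => gradient C p) q u, u⟫ ≤ ‖u‖ ^ 2 / β) :
    ∀ q r : EuclideanSpace ℝ (Fin K),
      (C (q + r) - C q) - (C q - C (q - r)) ≤ 2 * ‖r‖ ^ 2 / β := by
  intro q r
  have hd : Differentiable ℝ C := hC.differentiable (by norm_num)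
  have hG : Differentiable ℝ (fun p => gradient C p) := by
    have h1 : Differentiable ℝ (fderiv ℝ C) :=
      (hC.fderiv_right (m := 1) (by norm_num)).differentiable (by norm_num)
    exact (InnerProductSpace.toDual ℝ
      (EuclideanSpace ℝ (Fin K))).symm.toContinuousLinearEquiv.differentiable.comp h1
  have hline : ∀ t : ℝ, HasDerivAt (fun s : ℝ => q + s • r) r t := by
    intro t
    simpa using ((hasDerivAt_id t).smul_const r).const_add q
  have hline' : ∀ t : ℝ, HasDerivAt (fun s : ℝ => q - s • r) (-r) t := by
    intro t
    simpa using ((hasDerivAt_id t).smul_const r).const_sub q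
  have hc : ∀ p v : EuclideanSpace ℝ (Fin K), fderiv ℝ C p v = ⟪gradient C p, v⟫ := by
    intro p v
    simp [gradient]
  have hg : ∀ t : ℝ, HasDerivAt (fun s : ℝ => C (q + s • r) + C (q - s • r))
      (⟪gradient C (q + t • r), r⟫ - ⟪gradient C (q + (-t) • r), r⟫) t := by
    intro t
    have h1 := (hd (q + t • r)).hasFDerivAt.comp_hasDerivAt t (hline t)
    have h2 := (hd (q - t • r)).hasFDerivAt.comp_hasDerivAt t (hline' t)
    have h3 := h1.add h2
    rw [hc, hc, inner_neg_right, ← sub_eq_add_neg] at h3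
    rw [neg_smul, ← sub_eq_add_neg]
    exact h3
  have hh : ∀ t : ℝ, HasDerivAt (fun s : ℝ => ⟪gradient C (q + s • r), r⟫)
      ⟪fderiv ℝ (fun p => gradient C p) (q + t • r) r, r⟫ t := by
    intro t
    have h1 := (hG (q + t • r)).hasFDerivAt.comp_hasDerivAt t (hline t)
    have h2 := h1.inner ℝ (hasDerivAt_const t r)
    simpa using h2
  obtain ⟨c, hc01, hceq⟩ := exists_hasDerivAt_eq_slope _ _ (zero_lt_one' ℝ)
    (fun t _ => (hg t).continuousAt.continuousWithinAt) (fun t _ => hg t)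
  obtain ⟨d, -, hdeq⟩ := exists_hasDerivAt_eq_slope _ _ (show -c < c by linarith [hc01.1])
    (fun t _ => (hh t).continuousAt.continuousWithinAt) (fun t _ => hh t)
  have hL := hhess (q + d • r) r
  have hL0 : 0 ≤ ‖r‖ ^ 2 / β := by positivity
  have hcp := hc01.1
  have hc1 := hc01.2
  rw [hdeq, div_le_iff₀ (by linarith)] at hL
  simp only [one_smul, zero_smul, add_zero, sub_zero, div_one] at hceq
  rw [mul_div_assoc]
  nlinarith
end

section
/- Let β > 0, let S ⊆ ℝ^K be a nonempty bounded set, and let R : ℝ^K → ℝ. Suppose x₀ ∈ convexHull(S) minimizes R over convexHull(S), and that R(x) − R(x₀) ≥ (β/2)‖x − x₀‖² for all x ∈ convexHull(S). Then sup_{x ∈ S} (R(x) − R(x₀)) ≥ β · diam(S)² / 8, where diam(S) is the metric diameter of S. -/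
/-- **Lower bound on worst-case loss (Theorem 4, second part).**
If `x₀` minimizes `R` over the convex hull of a nonempty bounded payoff set `S`
and `R` is `β`-strongly convex at `x₀` over the hull, then the worst-case loss
`sup_{x ∈ S} (R x − R x₀)` is at least `β · diam(S)² / 8`; i.e., every upper
bound of `{R x − R x₀ : x ∈ S}` is at least `β · diam(S)² / 8`. -/
theorem worst_case_loss_lower_bound
    {K : ℕ} (β : ℝ) (hβ : 0 < β)
    (S : Set (EuclideanSpace ℝ (Fin K))) (hS : S.Nonempty)
    (hSbdd : Bornology.IsBounded S)
    (R : EuclideanSpace ℝ (Fin K) → ℝ)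
    (x₀ : EuclideanSpace ℝ (Fin K)) (hx₀ : x₀ ∈ convexHull ℝ S)
    (hmin : ∀ x ∈ convexHull ℝ S, R x₀ ≤ R x)
    (hstrong : ∀ x ∈ convexHull ℝ S, R x - R x₀ ≥ β / 2 * ‖x - x₀‖ ^ 2) :
    ∀ M ∈ upperBounds ((fun x => R x - R x₀) '' S),
      β * Metric.diam S ^ 2 / 8 ≤ M := by
  intro M hM
  have key : ∀ x ∈ S, β / 2 * ‖x - x₀‖ ^ 2 ≤ M := fun x hx =>
    le_trans (hstrong x (subset_convexHull ℝ S hx)) (hM ⟨x, hx, rfl⟩)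
  obtain ⟨z, hz⟩ := hS
  have hM0 : 0 ≤ M := le_trans (by positivity) (key z hz)
  have hr : ∀ x ∈ S, dist x x₀ ≤ √(2 * M / β) := by
    intro x hx
    rw [dist_eq_norm]
    apply Real.le_sqrt_of_sq_le
    rw [le_div_iff₀ hβ]
    linarith [key x hx]
  have hd : Metric.diam S ≤ 2 * √(2 * M / β) := by
    apply Metric.diam_le_of_forall_dist_le (by positivity)
    intro x hx y hy
    linarith [dist_triangle_right x y x₀, hr x hx, hr y hy]
  have h2 : Metric.diam S ^ 2 ≤ (2 * √(2 * M / β)) ^ 2 :=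
    pow_le_pow_left₀ Metric.diam_nonneg hd 2
  rw [mul_pow, Real.sq_sqrt (by positivity)] at h2
  have h3 := mul_le_mul_of_nonneg_left h2 hβ.le
  have h4 : β * (2 ^ 2 * (2 * M / β)) = 8 * M := by
    field_simp
    ring
  linarith
end

section
/- Let Π ⊆ ℝ^K be a compact convex set, let C : ℝ^K → ℝ be differentiable everywhere with ∇C(q) ∈ Π for every q ∈ ℝ^K, and let v ∈ ℝ^K with v ∉ Π. Then the set {⟨v, q⟩ − C(q) : q ∈ ℝ^K} is not bounded above; that is, the market maker's worst-case loss sup_q (⟨v, q⟩ − C(q) + C(0)) is infinite. -/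
open RealInnerProductSpace

/-- **Payoffs outside the price region give unbounded loss (Proposition 1).**
If all instantaneous price vectors `∇C(q)` lie in a compact convex set `Pi` and
some payoff vector `v` lies outside `Pi`, then the market maker's loss
`⟪v, q⟫ − C q + C 0` is unbounded above over quantity vectors `q`. -/
theorem unbounded_loss_of_payoff_outside_prices
    {K : ℕ} (Pi : Set (EuclideanSpace ℝ (Fin K)))
    (hPic : IsCompact Pi) (hPiconv : Convex ℝ Pi)
    (C : EuclideanSpace ℝ (Fin K) → ℝ)
    (hdiff : Differentiable ℝ C)
    (hgrad : ∀ q : EuclideanSpace ℝ (Fin K), gradient C q ∈ Pi)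
    (v : EuclideanSpace ℝ (Fin K)) (hv : v ∉ Pi) :
    ¬ BddAbove (Set.range fun q : EuclideanSpace ℝ (Fin K) => ⟪v, q⟫ - C q) := by
  rintro ⟨M, hM⟩
  obtain ⟨f, u, hf, hu⟩ := geometric_hahn_banach_closed_point hPiconv hPic.isClosed hv
  obtain ⟨w, rfl⟩ := (InnerProductSpace.toDual ℝ (EuclideanSpace ℝ (Fin K))).surjective f
  simp only [InnerProductSpace.toDual_apply_apply] at hf hu
  have hd : ∀ t : ℝ, HasDerivAt (fun t : ℝ => C (t • w)) ⟪gradient C (t • w), w⟫ t := by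
    intro t
    have h1 := (hdiff (t • w)).hasGradientAt.hasFDerivAt
    have h2 : HasDerivAt (fun t : ℝ => t • w) w t := by
      simpa using (hasDerivAt_id t).smul_const w
    have h3 := h1.comp_hasDerivAt t h2
    simpa [Function.comp_def] using h3
  have hle : ∀ t : ℝ, 0 ≤ t → C (t • w) - C 0 ≤ u * t := by
    intro t ht
    have h := image_sub_le_mul_sub_of_deriv_le (f := fun t : ℝ => C (t • w)) (C := u)
      (fun t => (hd t).differentiableAt)
      (fun t => by
        rw [(hd t).deriv, real_inner_comm]
        exact (hf _ (hgrad _)).le) ht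
    simpa using h
  have hpos : 0 < ⟪w, v⟫ - u := sub_pos.2 hu
  obtain ⟨n, hn⟩ := exists_nat_gt ((M + C 0) / (⟪w, v⟫ - u))
  rw [div_lt_iff₀ hpos] at hn
  have h1 := hM (Set.mem_range_self ((n : ℝ) • w))
  have h2 := hle n (Nat.cast_nonneg n)
  simp only [inner_smul_right, real_inner_comm w v] at h1
  rw [real_inner_comm] at hn
  first
    | nlinarith
    | (rw [real_inner_comm] at hn; nlinarith)
end

section
/- Let O be a nonempty type and ρ : O → ℝ^K a payoff function with H := convexHull(ρ(O)) compact. Let Π ⊆ ℝ^K be a compact convex set with H ⊆ Π, let R : ℝ^K → ℝ be continuous, and define C(q) = sup_{x ∈ Π} (⟨x, q⟩ − R(x)). Suppose x₀ ∈ Π attains the minimum of R over Π and x₀ ∈ H (the initial price vector lies in the convex hull of the payoffs). Fix q ∈ ℝ^K and o ∈ O, and suppose x_q ∈ Π attains the supremum defining C(q) and R is differentiable at x_q. Then ⟨ρ(o), q⟩ − C(q) + C(0) ≤ R(ρ(o)) − min_{x ∈ H} R(x) − D_R(ρ(o), x_q), where D_R(a, b) := R(a) − R(b) − ⟨∇R(b),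 a − b⟩. -/
open RealInnerProductSpace

/-- **Loss bound for a relaxed price region (Proposition 2).**
With a relaxed compact convex price region `Pi ⊇ H := convexHull (ρ(O))`,
continuous conjugate `R`, cost `C q = sup_{x ∈ Pi} (⟪x, q⟫ − R x)`, initial price
vector (the minimizer of `R` over `Pi`) lying in `H`, and the supremum at `q`
attained at `x_q` where `R` is differentiable, the market maker's loss is at
most `R(ρ(o)) − min_{x ∈ H} R(x) − D_R(ρ(o), x_q)`. -/
theorem relaxed_market_maker_loss_bound
    {K : ℕ} {O : Type*} [Nonempty O]
    (ρ : O → EuclideanSpace ℝ (Fin K))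
    (hHc : IsCompact (convexHull ℝ (Set.range ρ)))
    (Pi : Set (EuclideanSpace ℝ (Fin K)))
    (hPic : IsCompact Pi) (hPiconv : Convex ℝ Pi)
    (hHPi : convexHull ℝ (Set.range ρ) ⊆ Pi)
    (R : EuclideanSpace ℝ (Fin K) → ℝ) (hRcont : Continuous R)
    (C : EuclideanSpace ℝ (Fin K) → ℝ)
    (hC : ∀ q : EuclideanSpace ℝ (Fin K),
      C q = sSup ((fun x => ⟪x, q⟫ - R x) '' Pi))
    (x₀ : EuclideanSpace ℝ (Fin K)) (hx₀Pi : x₀ ∈ Pi)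
    (hx₀min : ∀ x ∈ Pi, R x₀ ≤ R x)
    (hx₀H : x₀ ∈ convexHull ℝ (Set.range ρ))
    (q : EuclideanSpace ℝ (Fin K)) (o : O)
    (xq : EuclideanSpace ℝ (Fin K)) (hxq : xq ∈ Pi)
    (hattain : C q = ⟪xq, q⟫ - R xq)
    (hdiff : DifferentiableAt ℝ R xq) :
    ⟪ρ o, q⟫ - C q + C 0 ≤
      R (ρ o) - sInf (R '' convexHull ℝ (Set.range ρ))
        - (R (ρ o) - R xq - ⟪gradient R xq, ρ o - xq⟫) := by
  have hρ : ρ o ∈ Pi := hHPi (subset_convexHull ℝ _ ⟨o, rfl⟩)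
  have hC0 : C 0 = - R x₀ := by
    rw [hC 0]
    apply IsGreatest.csSup_eq
    refine ⟨⟨x₀, hx₀Pi, by simp⟩, ?_⟩
    rintro _ ⟨x, hx, rfl⟩
    have := hx₀min x hx
    simpa using this
  have hInf : sInf (R '' convexHull ℝ (Set.range ρ)) = R x₀ := by
    apply IsLeast.csInf_eq
    refine ⟨⟨x₀, hx₀H, rfl⟩, ?_⟩
    rintro _ ⟨x, hx, rfl⟩
    exact hx₀min x (hHPi hx)
  have hmax : IsMaxOn (fun x => ⟪q, x⟫ - R x) Pi xq := by
    intro x hx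
    have hbdd : BddAbove ((fun x => ⟪x, q⟫ - R x) '' Pi) :=
      (hPic.image (by fun_prop)).bddAbove
    have h1 : ⟪x, q⟫ - R x ≤ C q := by
      rw [hC q]
      exact le_csSup hbdd ⟨x, hx, rfl⟩
    rw [hattain] at h1
    simpa [real_inner_comm] using h1
  have hR : HasFDerivAt R (innerSL ℝ (gradient R xq)) xq := hdiff.hasGradientAt.hasFDerivAt
  have hf : HasFDerivAt (fun x => ⟪q, x⟫ - R x)
      (innerSL ℝ q - innerSL ℝ (gradient R xq)) xq :=
    (innerSL ℝ q).hasFDerivAt.sub hR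
  have hcone : ρ o - xq ∈ posTangentConeAt Pi xq :=
    sub_mem_posTangentConeAt_of_segment_subset (hPiconv.segment_subset hxq hρ)
  have key := hmax.localize.hasFDerivWithinAt_nonpos hf.hasFDerivWithinAt hcone
  simp only [ContinuousLinearMap.sub_apply, innerSL_apply_apply] at key
  have e : ⟪q, ρ o - xq⟫ = ⟪ρ o, q⟫ - ⟪xq, q⟫ := by
    rw [inner_sub_right, real_inner_comm, real_inner_comm xq]
  rw [hC0, hInf, hattain]
  linarith
end

section
/- Let O be a nonempty type and ρ : O → ℝ^K a payoff function with H := convexHull(ρ(O)) compact and nonempty. Let Π ⊆ ℝ^K be a compact convex set with H ⊆ Π, let R : ℝ^K → ℝ be convex and continuous, and define C(q) = sup_{x ∈ Π} (⟨x, q⟩ − R(x)). Fix q₀ ∈ ℝ^K, suppose x₀ ∈ Π attains the supremum defining C(q₀), and suppose R is differentiable at x₀. Then the guaranteed profit available to a trader satisfies sup_{r ∈ ℝ^K} inf_{x ∈ H} (⟨x, r⟩ − C(q₀ + r) + C(q₀)) ≥ inf_{x ∈ H} D_R(x, x₀), where D_R(a, b) := R(a) − R(b) − ⟨∇R(b),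 a − b⟩. -/
open RealInnerProductSpace

/-- **Guaranteed arbitrage profit from prices outside the hull (Proposition 3).**
With price region `Pi ⊇ H := convexHull (ρ(O))`, convex continuous conjugate `R`,
cost `C q = sup_{x ∈ Pi} (⟪x, q⟫ − R x)`, current quantity vector `q₀` whose
supremum is attained at the current price vector `x₀` where `R` is
differentiable, a trader can guarantee a profit of at least
`min_{x ∈ H} D_R(x, x₀)`. -/
theorem guaranteed_profit_bound
    {K : ℕ} {O : Type*} [Nonempty O]
    (ρ : O → EuclideanSpace ℝ (Fin K))
    (hHc : IsCompact (convexHull ℝ (Set.range ρ)))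
    (Pi : Set (EuclideanSpace ℝ (Fin K)))
    (hPic : IsCompact Pi) (hPiconv : Convex ℝ Pi)
    (hHPi : convexHull ℝ (Set.range ρ) ⊆ Pi)
    (R : EuclideanSpace ℝ (Fin K) → ℝ)
    (hRconv : ConvexOn ℝ Set.univ R) (hRcont : Continuous R)
    (C : EuclideanSpace ℝ (Fin K) → ℝ)
    (hC : ∀ q : EuclideanSpace ℝ (Fin K),
      C q = sSup ((fun x => ⟪x, q⟫ - R x) '' Pi))
    (q₀ : EuclideanSpace ℝ (Fin K))
    (x₀ : EuclideanSpace ℝ (Fin K)) (hx₀ : x₀ ∈ Pi)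
    (hattain : C q₀ = ⟪x₀, q₀⟫ - R x₀)
    (hdiff : DifferentiableAt ℝ R x₀) :
    sSup (Set.range fun r : EuclideanSpace ℝ (Fin K) =>
        sInf ((fun x => ⟪x, r⟫ - C (q₀ + r) + C q₀) '' convexHull ℝ (Set.range ρ)))
      ≥ sInf ((fun x => R x - R x₀ - ⟪gradient R x₀, x - x₀⟫) ''
          convexHull ℝ (Set.range ρ)) := by
  have hbdd : ∀ q, BddAbove ((fun x => ⟪x, q⟫ - R x) '' Pi) := fun q =>
    (hPic.image (by fun_prop)).bddAbove
  have hCge : ∀ q, ∀ x ∈ Pi, ⟪x, q⟫ - R x ≤ C q := by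
    intro q x hx
    rw [hC q]
    exact le_csSup (hbdd q) ⟨x, hx, rfl⟩
  have hHne : (convexHull ℝ (Set.range ρ)).Nonempty := (Set.range_nonempty ρ).convexHull
  have hmin : IsMinOn (fun x => R x - ⟪q₀, x⟫) Pi x₀ := by
    intro x hx
    have := hCge q₀ x hx
    rw [hattain, real_inner_comm q₀ x, real_inner_comm q₀ x₀] at this
    simp only [Set.mem_ofPred_eq]
    linarith
  have hfirst : ∀ x ∈ Pi, 0 ≤ ⟪gradient R x₀, x - x₀⟫ - ⟪q₀, x - x₀⟫ := by
    intro x hx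
    have hd : HasFDerivAt (fun x => R x - ⟪q₀, x⟫)
        (innerSL ℝ (gradient R x₀) - innerSL ℝ q₀) x₀ :=
      hdiff.hasGradientAt.hasFDerivAt.sub (innerSL ℝ q₀).hasFDerivAt
    have := hmin.localize.hasFDerivWithinAt_nonneg hd.hasFDerivWithinAt
      (sub_mem_posTangentConeAt_of_segment_subset (hPiconv.segment_subset hx₀ hx))
    simpa using this
  set m := sInf ((fun x => R x - R x₀ - ⟪gradient R x₀, x - x₀⟫) ''
          convexHull ℝ (Set.range ρ)) with hm
  have hmle : ∀ x ∈ convexHull ℝ (Set.range ρ),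
      m ≤ R x - ⟪q₀, x⟫ + C q₀ := by
    intro x hx
    have h1 : m ≤ R x - R x₀ - ⟪gradient R x₀, x - x₀⟫ :=
      csInf_le (hHc.image (by fun_prop)).bddBelow ⟨x, hx, rfl⟩
    have h2 := hfirst x (hHPi hx)
    rw [inner_sub_right q₀] at h2
    rw [hattain, real_inner_comm q₀ x₀]
    linarith
  have hbA : BddAbove (Set.range fun r : EuclideanSpace ℝ (Fin K) =>
        sInf ((fun x => ⟪x, r⟫ - C (q₀ + r) + C q₀) '' convexHull ℝ (Set.range ρ))) := by
    obtain ⟨x, hx⟩ := hHne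
    refine ⟨R x - ⟪x, q₀⟫ + C q₀, ?_⟩
    rintro _ ⟨r, rfl⟩
    have h1 : sInf ((fun x => ⟪x, r⟫ - C (q₀ + r) + C q₀) '' convexHull ℝ (Set.range ρ))
        ≤ ⟪x, r⟫ - C (q₀ + r) + C q₀ :=
      csInf_le (hHc.image (by fun_prop)).bddBelow ⟨x, hx, rfl⟩
    have h2 := hCge (q₀ + r) x (hHPi hx)
    rw [inner_add_right] at h2
    show sInf _ ≤ _
    linarith
  refine le_of_forall_lt fun c hc => ?_
  obtain ⟨c', hcc', hc'⟩ := exists_between hc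
  refine lt_of_lt_of_le hcc' ?_
  let g : EuclideanSpace ℝ (Fin K) → ℝ := fun x => R x - ⟪q₀, x⟫ + C q₀
  have hgc : Continuous g := by fun_prop
  have hgconv : ConvexOn ℝ Pi g := by
    have h1 : ConvexOn ℝ Pi R := hRconv.subset (Set.subset_univ _) hPiconv
    have h2 : ConcaveOn ℝ Pi (fun x => ⟪q₀, x⟫) :=
      (innerSL ℝ q₀).toLinearMap.concaveOn hPiconv
    exact (h1.sub h2).add_const (C q₀)
  have hAconv : Convex ℝ {p : EuclideanSpace ℝ (Fin K) × ℝ | p.1 ∈ Pi ∧ g p.1 ≤ p.2} :=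
    hgconv.convex_epigraph
  have hAclosed : IsClosed {p : EuclideanSpace ℝ (Fin K) × ℝ | p.1 ∈ Pi ∧ g p.1 ≤ p.2} :=
    (hPic.isClosed.preimage continuous_fst).inter
      (isClosed_le (hgc.comp continuous_fst) continuous_snd)
  obtain ⟨f, u, v, hfu, huv, hfv⟩ := geometric_hahn_banach_compact_closed
    ((convex_convexHull ℝ (Set.range ρ)).prod (convex_singleton c'))
    (hHc.prod (isCompact_singleton (x := c'))) hAconv hAclosed (by
      rw [Set.disjoint_left]
      rintro ⟨x, t⟩ ⟨hx, ht⟩ ⟨-, h2⟩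
      have := hmle x hx
      simp only [Set.mem_singleton_iff] at ht
      simp only [g] at h2
      linarith)
  let a := (InnerProductSpace.toDual ℝ (EuclideanSpace ℝ (Fin K))).symm
    (f.comp (ContinuousLinearMap.inl ℝ (EuclideanSpace ℝ (Fin K)) ℝ))
  let b := f (0, 1)
  have hf : ∀ x t, f (x, t) = ⟪x, a⟫ + t * b := by
    intro x t
    have h1 : ((x, t) : EuclideanSpace ℝ (Fin K) × ℝ) = (x, 0) + t • (0, 1) := by simp
    rw [h1, map_add, map_smul, real_inner_comm]
    simp [a, b, InnerProductSpace.toDual_symm_apply]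
  have key : ∀ x ∈ convexHull ℝ (Set.range ρ), ∀ y ∈ Pi,
      ⟪x, a⟫ + c' * b < ⟪y, a⟫ + g y * b := by
    intro x hx y hy
    rw [← hf, ← hf]
    exact (hfu (x, c') ⟨hx, rfl⟩).trans (huv.trans (hfv (y, g y) ⟨hy, le_rfl⟩))
  have hb : 0 < b := by
    obtain ⟨x, hx⟩ := hHne
    have h1 := key x hx x (hHPi hx)
    have h2 : m ≤ g x := hmle x hx
    have h3 : 0 < (g x - c') * b := by linarith
    exact (pos_iff_pos_of_mul_pos h3).1 (by linarith)
  refine le_trans ?_ (le_csSup hbA ⟨-(b⁻¹ • a), rfl⟩)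
  refine le_csInf (hHne.image _) ?_
  rintro _ ⟨x, hx, rfl⟩
  have : C (q₀ + -(b⁻¹ • a)) ≤ ⟪x, -(b⁻¹ • a)⟫ + C q₀ - c' := by
    rw [hC (q₀ + -(b⁻¹ • a))]
    refine csSup_le (Set.Nonempty.image _ ⟨x₀, hx₀⟩) ?_
    rintro _ ⟨y, hy, rfl⟩
    have h1 := key x hx y hy
    have h2 : b⁻¹ * (⟪x, a⟫ + c' * b) ≤ b⁻¹ * (⟪y, a⟫ + g y * b) :=
      mul_le_mul_of_nonneg_left h1.le (inv_pos.2 hb).le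
    have h3 : b⁻¹ * (⟪x, a⟫ + c' * b) = b⁻¹ * ⟪x, a⟫ + c' := by field_simp
    have h4 : b⁻¹ * (⟪y, a⟫ + g y * b) = b⁻¹ * ⟪y, a⟫ + g y := by field_simp
    rw [h3, h4] at h2
    simp only [inner_add_right, inner_neg_right, inner_smul_right, g,
      real_inner_comm y q₀] at h2 ⊢
    linarith
  show c' ≤ _ - _ + _
  linarith
end

section
/- Let O be a nonempty type and ρ : O → ℝ^K a payoff function with H := convexHull(ρ(O)). Let C : ℝ^K → ℝ be strictly convex. Let s, s' ∈ ℝ^K with s ≠ s', suppose C is differentiable at s' with gradient p := ∇C(s'), and suppose ⟨s' − s, x − p⟩ ≥ 0 for every x ∈ H. Then for every outcome o ∈ O, ⟨ρ(o), s' − s⟩ + C(s) − C(s') > 0; that is, relative to a trade moving the quantity vector to s, the alternative trade moving it to s' yields a strictly larger profit regardless of the outcome. -/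
open RealInnerProductSpace

/-- **Moving prices back toward the hull strictly improves profit.**
Let `C` be strictly convex and differentiable at `s'` with `p = ∇C(s')`, and
suppose `⟪s' − s, x − p⟫ ≥ 0` for all `x` in the convex hull `H` of the payoffs
(the first-order optimality condition of the Bregman projection). Then, for
every outcome `o`, the trade moving the quantity vector to `s'` yields strictly
more profit than the trade moving it to `s`:
`⟪ρ(o), s' − s⟫ + C s − C s' > 0`. -/
theorem projection_trade_strictly_better
    {K : ℕ} {O : Type*} [Nonempty O]
    (ρ : O → EuclideanSpace ℝ (Fin K))
    (C : EuclideanSpace ℝ (Fin K) → ℝ)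
    (hC : StrictConvexOn ℝ Set.univ C)
    (s s' : EuclideanSpace ℝ (Fin K)) (hne : s ≠ s')
    (hdiff : DifferentiableAt ℝ C s')
    (hopt : ∀ x ∈ convexHull ℝ (Set.range ρ),
      ⟪s' - s, x - gradient C s'⟫ ≥ 0) :
    ∀ o : O, ⟪ρ o, s' - s⟫ + C s - C s' > 0 := by
  intro o
  have hv : s - s' ≠ 0 := sub_ne_zero.mpr hne
  have hg : StrictConvexOn ℝ Set.univ (fun t : ℝ => C (s' + t • (s - s'))) := by
    refine ⟨convex_univ, ?_⟩
    intro x _ y _ hxy a b ha hb hab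
    have hne' : s' + x • (s - s') ≠ s' + y • (s - s') := by
      intro h
      exact hxy (smul_left_injective ℝ hv (add_left_cancel h))
    have h := hC.2 (Set.mem_univ _) (Set.mem_univ _) hne' ha hb hab
    have e : s' + (a • x + b • y) • (s - s')
        = a • (s' + x • (s - s')) + b • (s' + y • (s - s')) := by
      have hb' : b = 1 - a := by linarith
      subst hb'
      simp only [smul_eq_mul]
      module
    simpa only [e] using h
  have hd : HasDerivAt (fun t : ℝ => C (s' + t • (s - s')))
      (inner ℝ (gradient C s') (s - s')) 0 := by
    have h1 : HasDerivAt (fun t : ℝ => s' + t • (s - s')) (s - s') 0 := by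
      simpa using ((hasDerivAt_id (0 : ℝ)).smul_const (s - s')).const_add s'
    have h2 := hdiff.hasGradientAt.hasFDerivAt
    have h3 : s' = s' + (0 : ℝ) • (s - s') := by simp
    have h4 := HasFDerivAt.comp_hasDerivAt_of_eq (0 : ℝ) h2 h1 h3
    exact h4
  have hs := hg.lt_slope_of_hasDerivAt (Set.mem_univ 0) (Set.mem_univ 1) one_pos hd
  have hs' : inner ℝ (gradient C s') (s - s') < C s - C s' := by
    have e : slope (fun t : ℝ => C (s' + t • (s - s'))) 0 1 = C s - C s' := by
      simp [slope_def_field]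
    rwa [e] at hs
  have ho := hopt (ρ o) (subset_convexHull ℝ _ ⟨o, rfl⟩)
  rw [real_inner_comm, inner_sub_left] at ho
  rw [← neg_sub s' s, inner_neg_right] at hs'
  linarith
end
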